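/- arXiv:2510.12129 — 5 statements merged into one kernel-verified Lean document; each statement's English description precedes it below -/
import Mathlib

section
/- Let q = (q₁,q₂) : ℝ × ℝ → ℂ² be smooth, set r = (−q₁*, −q₂*) (so Q† = −Q), and let U(λ) = iλσ₃ + Q and V(λ) = V_CNLS(λ). Let λ₁,…,λ_N ∈ ℂ be pairwise distinct with Im λ_k > 0, and for each k let y_k : ℝ × ℝ → ℂ³ be a smooth solution of ∂_x y_k = U(λ_k) y_k and ∂_t y_k = V(λ_k) y_k. Assume the N×N matrix M(x,t) with entries M_{k,l} = ((λ_k − λ_k*)/(λ_l − λ_k*)) · (y_k† y_l) is invertible at every (x,t), and define vectors x₁,…,x_N : ℝ × ℝ → ℂ³ by (y₁,…,y_N) = (x₁,…,x_N) M (i.e., the x_k are the columns of Y M⁻¹ where Y has columns y_k). Define the Darboux matrix D_r(λ) = I₃ − Σ_{k=1}^{N} ((λ_k − λ_k*)/(λ − λ_k*)) x_k y_k† and the new potential Q^[N] = Q + 2iσ₃ Σ_{k=1}^{N} (λ_k − λ_k*) · ( x_k y_k† − σ₃ (x_k y_k†) σ₃ ) / 2. Then for every λ ∈ ℂ \ {λ₁*,…,λ_N*}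 and every smooth Φ : ℝ × ℝ → M₃(ℂ) satisfying ∂_x Φ = U(λ,Q) Φ and ∂_t Φ = V_CNLS(λ,Q) Φ, the function Φ^[N] = D_r(λ) Φ satisfies ∂_x Φ^[N] = U(λ,Q^[N]) Φ^[N] and ∂_t Φ^[N] = V_CNLS(λ,Q^[N]) Φ^[N]. -/
open Matrix Complex BigOperators

noncomputable section

abbrev M3 : Type := Matrix (Fin 3) (Fin 3) ℂ

def sigma3 : M3 := Matrix.diagonal ![1, -1, -1]

/-- Entrywise x-derivative of a matrix-valued function. -/
def pdxM (F : ℝ → ℝ → M3) : ℝ → ℝ → M3 :=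
  fun x t => Matrix.of fun i j => deriv (fun x' => F x' t i j) x

/-- Entrywise t-derivative of a matrix-valued function. -/
def pdtM (F : ℝ → ℝ → M3) : ℝ → ℝ → M3 :=
  fun x t => Matrix.of fun i j => deriv (fun t' => F x t' i j) t

/-- Componentwise x-derivative of a ℂ³-valued function. -/
def pdxV (f : ℝ → ℝ → Fin 3 → ℂ) : ℝ → ℝ → Fin 3 → ℂ :=
  fun x t i => deriv (fun x' => f x' t i) x

/-- Componentwise t-derivative of a ℂ³-valued function. -/
def pdtV (f : ℝ → ℝ → Fin 3 → ℂ) : ℝ → ℝ → Fin 3 → ℂ :=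
  fun x t i => deriv (fun t' => f x t' i) t

/-- The potential matrix `Q` with first row `(0,r₁,r₂)` and first column `(0,q₁,q₂)ᵀ`. -/
def Qmat (q r : ℝ → ℝ → Fin 2 → ℂ) : ℝ → ℝ → M3 :=
  fun x t => !![0, r x t 0, r x t 1; q x t 0, 0, 0; q x t 1, 0, 0]

/-- The spatial Lax matrix `U(λ) = iλσ₃ + Q`. -/
def Umat (lam : ℂ) (Q : ℝ → ℝ → M3) : ℝ → ℝ → M3 :=
  fun x t => (Complex.I * lam) • sigma3 + Q x t

/-- The CNLS temporal Lax matrix `V = 2iλ²σ₃ + 2λQ + iσ₃(Q² − Q_x)`. -/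
def Vcnls (lam : ℂ) (Q : ℝ → ℝ → M3) : ℝ → ℝ → M3 :=
  fun x t => (2 * Complex.I * lam ^ 2) • sigma3 + (2 * lam) • Q x t
    + Complex.I • (sigma3 * (Q x t * Q x t - pdxM Q x t))

/-- Off-diagonal projection `(A − σ₃Aσ₃)/2`. -/
def offdiag (A : M3) : M3 := (2 : ℂ)⁻¹ • (A - sigma3 * A * sigma3)

section EntryDeriv

variable {m n p : Type*}

/-- Entrywise derivative of a matrix-valued function of a real variable. -/
def HasEntryDeriv (F : ℝ → Matrix m n ℂ) (F' : Matrix m n ℂ) (s : ℝ) : Prop :=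
  ∀ i j, HasDerivAt (fun s => F s i j) (F' i j) s

namespace HasEntryDeriv

variable {F G : ℝ → Matrix m n ℂ} {F' G' : Matrix m n ℂ} {s : ℝ}

theorem of_deriv_eq (h : HasEntryDeriv F F' s) :
    (Matrix.of fun i j => deriv (fun s => F s i j) s) = F' := by
  ext i j
  exact (h i j).deriv

theorem unique (h : HasEntryDeriv F F' s) (h' : HasEntryDeriv F G' s) : F' = G' :=
  h.of_deriv_eq.symm.trans h'.of_deriv_eq

theorem const (A : Matrix m n ℂ) (s : ℝ) : HasEntryDeriv (fun _ => A) 0 s :=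
  fun i j => hasDerivAt_const s (A i j)

theorem add (hF : HasEntryDeriv F F' s) (hG : HasEntryDeriv G G' s) :
    HasEntryDeriv (fun s => F s + G s) (F' + G') s :=
  fun i j => (hF i j).add (hG i j)

theorem sub (hF : HasEntryDeriv F F' s) (hG : HasEntryDeriv G G' s) :
    HasEntryDeriv (fun s => F s - G s) (F' - G') s :=
  fun i j => (hF i j).sub (hG i j)

theorem const_smul (c : ℂ) (hF : HasEntryDeriv F F' s) :
    HasEntryDeriv (fun s => c • F s) (c • F') s :=
  fun i j => (hF i j).const_mul c

theorem mul [Fintype n] {H : ℝ → Matrix n p ℂ} {H' : Matrix n p ℂ}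
    (hF : HasEntryDeriv F F' s) (hH : HasEntryDeriv H H' s) :
    HasEntryDeriv (fun s => F s * H s) (F' * H s + F s * H') s := by
  intro i j
  simp only [Matrix.mul_apply, Matrix.add_apply, ← Finset.sum_add_distrib]
  exact HasDerivAt.fun_sum fun k _ => (hF i k).mul (hH k j)

theorem conjTranspose (hF : HasEntryDeriv F F' s) :
    HasEntryDeriv (fun s => (F s)ᴴ) F'ᴴ s :=
  fun i j => (hF j i).star

end HasEntryDeriv

theorem Matrix.differentiableAt_det [Fintype n] [DecidableEq n] {K : ℝ → Matrix n n ℂ} {s : ℝ}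
    (hK : ∀ i j, DifferentiableAt ℝ (fun s => K s i j) s) :
    DifferentiableAt ℝ (fun s => (K s).det) s := by
  simp only [Matrix.det_apply']
  exact DifferentiableAt.fun_sum fun σ _ =>
    (DifferentiableAt.fun_finsetProd fun i _ => hK _ _).const_mul _

theorem Matrix.differentiableAt_inv_apply [Fintype n] [DecidableEq n] {K : ℝ → Matrix n n ℂ}
    {s : ℝ} (hK : ∀ i j, DifferentiableAt ℝ (fun s => K s i j) s) (hu : IsUnit (K s)) (i j : n) :
    DifferentiableAt ℝ (fun s => (K s)⁻¹ i j) s := by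
  have hadj : DifferentiableAt ℝ (fun s => (K s).adjugate i j) s := by
    simp only [Matrix.adjugate_apply]
    refine Matrix.differentiableAt_det fun a b => ?_
    by_cases h : a = j
    · subst h
      simp
    · simpa [Matrix.updateRow_ne h] using hK a b
  simp only [Matrix.inv_def, Ring.inverse_eq_inv', Matrix.smul_apply, smul_eq_mul]
  exact ((Matrix.differentiableAt_det hK).inv
    ((Matrix.isUnit_iff_isUnit_det _).1 hu).ne_zero).mul hadj

/-- If `Y = P K` with `Y` and `K` differentiable and `K` invertible, then `P` is differentiable. -/
theorem HasEntryDeriv.exists_of_mul_right [Fintype n] [DecidableEq n] {Y P : ℝ → Matrix m n ℂ}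
    {K : ℝ → Matrix n n ℂ} {Y' : Matrix m n ℂ} {K' : Matrix n n ℂ} {s : ℝ}
    (hY : HasEntryDeriv Y Y' s) (hK : HasEntryDeriv K K' s) (hu : ∀ s, IsUnit (K s))
    (h : ∀ s, Y s = P s * K s) :
    ∃ P', HasEntryDeriv P P' s ∧ Y' = P' * K s + P s * K' := by
  have hinv : HasEntryDeriv (fun s => (K s)⁻¹)
      (Matrix.of fun i j => deriv (fun s => (K s)⁻¹ i j) s) s := fun i j =>
    (Matrix.differentiableAt_inv_apply (fun a b => (hK a b).differentiableAt) (hu s) i j).hasDerivAt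
  have hP : P = fun s => Y s * (K s)⁻¹ := by
    funext s
    rw [h s, Matrix.mul_assoc, Matrix.mul_nonsing_inv _ ((Matrix.isUnit_iff_isUnit_det _).1 (hu s)),
      Matrix.mul_one]
  obtain ⟨P', hP'⟩ : ∃ P', HasEntryDeriv P P' s := ⟨_, hP ▸ hY.mul hinv⟩
  have hPK := hP'.mul hK
  simp only [← h] at hPK
  exact ⟨P', hP', hY.unique hPK⟩

/-- Differentiation of the solution `K` of the Sylvester equation `K L - B K = G`. -/
theorem HasEntryDeriv.sylvester [Fintype n] [DecidableEq n] {a b : n → ℂ}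
    (hab : ∀ k l, a l - b k ≠ 0)
    {G K : ℝ → Matrix n n ℂ} {G' H : Matrix n n ℂ} {s : ℝ} (hG : HasEntryDeriv G G' s)
    (hK : ∀ s, K s * diagonal a - diagonal b * K s = G s)
    (hH : H * diagonal a - diagonal b * H = G') : HasEntryDeriv K H s := by
  have key : ∀ A C : Matrix n n ℂ, A * diagonal a - diagonal b * A = C →
      ∀ k l, A k l = C k l / (a l - b k) := by
    rintro A _ rfl k l
    rw [eq_div_iff (hab k l)]
    simp only [Matrix.sub_apply, Matrix.mul_diagonal, Matrix.diagonal_mul]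
    ring
  intro k l
  simp only [fun s => key _ _ (hK s) k l, key _ _ hH k l]
  exact (hG k l).div_const _

end EntryDeriv

section Dressing

variable {m n : Type*} [Fintype m] [Fintype n] [DecidableEq n]
  {σ Q QN V₀ : Matrix m m ℂ} {P P' Y : Matrix m n ℂ} {Z : Matrix n m ℂ}
  {B K L R : Matrix n n ℂ} {c : ℂ}

/-- The spatial equation for the dressing vectors. -/
theorem dressing_spatial (hu : IsUnit K) (hY : Y = P * K) (hK : K * L - B * K = Z * Y)
    (hQN : QN = Q + I • (σ * (P * Z) - P * Z * σ))
    (h : I • (σ * Y * L) + Q * Y = P' * K + P * (I • (Z * σ * Y))) :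
    P' = I • (σ * P * B) + QN * P := by
  let := hu.invertible
  apply Matrix.mul_left_injective_of_invertible K
  have hKL : K * L = B * K + Z * (P * K) := by rw [← hY, ← hK]; abel
  have h' := eq_sub_of_add_eq h.symm
  simp only [h', hQN, hY, Matrix.mul_assoc, hKL, Matrix.mul_add, Matrix.add_mul, Matrix.sub_mul,
    Matrix.smul_mul, Matrix.mul_smul]
  module

/-- The temporal equation for the dressing vectors. -/
theorem dressing_temporal (hu : IsUnit K) (hY : Y = P * K) (hK : K * L - B * K = Z * Y)
    (hQN : QN = Q + I • (σ * (P * Z) - P * Z * σ))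
    (h : (2 * I) • (σ * Y * L * L) + (2 : ℂ) • (Q * Y * L) + V₀ * Y = P' * K +
      P * ((2 * I) • (Z * σ * Y * L) + (2 * I) • (B * Z * σ * Y) + (2 : ℂ) • (Z * Q * Y))) :
    P' = (2 * I) • (σ * P * B * B) + (2 : ℂ) • (QN * P * B) +
      (V₀ + (2 : ℂ) • (QN * (P * Z) - P * Z * Q) +
        (2 * I) • (σ * (P * B * Z) - P * B * Z * σ)) * P := by
  let := hu.invertible
  apply Matrix.mul_left_injective_of_invertible K
  have hKL : K * L = B * K + Z * (P * K) := by rw [← hY, ← hK]; abel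
  have h' := eq_sub_of_add_eq h.symm
  simp only [h', hQN, hY, Matrix.mul_assoc, hKL, Matrix.mul_add, Matrix.add_mul,
    Matrix.sub_mul, Matrix.smul_mul, Matrix.mul_smul, smul_add, smul_sub]
  module

variable [DecidableEq m]

theorem darboux_spatial (hBR : B * R = c • R - 1) (hRB : R * B = c • R - 1)
    (hQN : QN = Q + I • (σ * (P * Z) - P * Z * σ)) :
    -((I • (σ * P * B) + QN * P) * R * Z - P * R * (I • (B * Z * σ) + Z * Q)) =
      ((I * c) • σ + QN) * (1 - P * R * Z) - (1 - P * R * Z) * ((I * c) • σ + Q) := by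
  have hBR' (A : Matrix n m ℂ) : B * (R * A) = c • (R * A) - A := by
    rw [← Matrix.mul_assoc, hBR, Matrix.sub_mul, Matrix.smul_mul, Matrix.one_mul]
  have hRB' (A : Matrix n m ℂ) : R * (B * A) = c • (R * A) - A := by
    rw [← Matrix.mul_assoc, hRB, Matrix.sub_mul, Matrix.smul_mul, Matrix.one_mul]
  simp only [Matrix.mul_assoc, Matrix.mul_add, Matrix.add_mul, Matrix.sub_mul, Matrix.mul_sub,
    Matrix.smul_mul, Matrix.mul_smul, hBR', hRB', Matrix.mul_one, Matrix.one_mul, smul_sub]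
  rw [hQN]
  simp only [Matrix.mul_assoc, Matrix.add_mul, Matrix.sub_mul, Matrix.smul_mul]
  module

theorem darboux_temporal (hBR : B * R = c • R - 1) (hRB : R * B = c • R - 1)
    (hQN : QN = Q + I • (σ * (P * Z) - P * Z * σ)) {W : Matrix m m ℂ}
    (hW : W = V₀ + (2 : ℂ) • (QN * (P * Z) - P * Z * Q) +
        (2 * I) • (σ * (P * B * Z) - P * B * Z * σ)) :
    -(((2 * I) • (σ * P * B * B) + (2 : ℂ) • (QN * P * B) + W * P) * R * Z -
        P * R * ((2 * I) • (B * B * Z * σ) + (2 : ℂ) • (B * Z * Q) + Z * V₀)) =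
      ((2 * I * c ^ 2) • σ + (2 * c) • QN + W) * (1 - P * R * Z) -
        (1 - P * R * Z) * ((2 * I * c ^ 2) • σ + (2 * c) • Q + V₀) := by
  have hBR' (A : Matrix n m ℂ) : B * (R * A) = c • (R * A) - A := by
    rw [← Matrix.mul_assoc, hBR, Matrix.sub_mul, Matrix.smul_mul, Matrix.one_mul]
  have hRB' (A : Matrix n m ℂ) : R * (B * A) = c • (R * A) - A := by
    rw [← Matrix.mul_assoc, hRB, Matrix.sub_mul, Matrix.smul_mul, Matrix.one_mul]
  have hexp : ((2 * I * c ^ 2) • σ + (2 * c) • QN + W) * (1 - P * R * Z) =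
      (2 * I * c ^ 2) • (σ * (1 - P * R * Z)) +
        (2 * c) • (Q + I • (σ * (P * Z) - P * Z * σ) - QN * (P * R * Z)) +
        (V₀ + (2 : ℂ) • (QN * (P * Z) - P * Z * Q) +
          (2 * I) • (σ * (P * B * Z) - P * B * Z * σ) - W * (P * R * Z)) := by
    rw [← hQN, ← hW]
    simp only [Matrix.add_mul, Matrix.mul_sub, Matrix.mul_one, Matrix.smul_mul, smul_sub]
    abel
  rw [hexp]
  simp only [Matrix.mul_assoc, Matrix.mul_add, Matrix.add_mul, Matrix.sub_mul, Matrix.mul_sub,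
    Matrix.smul_mul, Matrix.mul_smul, hBR', hRB', Matrix.mul_one, Matrix.one_mul, smul_add,
    smul_sub]
  module

/-- The zeroth order coefficient of the dressed temporal Lax matrix. -/
theorem dressed_temporal_coeff (hσ : σ * σ = 1) {Q' S S' T : Matrix m m ℂ}
    (hQσ : Q * σ = -(σ * Q))
    (hQN : QN = Q + I • (σ * S - S * σ))
    (hS' : S' = QN * S - S * Q + I • (σ * T - T * σ)) :
    I • (σ * (QN * QN - (Q' + I • (σ * S' - S' * σ)))) =
      I • (σ * (Q * Q - Q')) + (2 : ℂ) • (QN * S - S * Q) + (2 * I) • (σ * T - T * σ) := by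
  have hσ' (A : Matrix m m ℂ) : σ * (σ * A) = A := by
    rw [← Matrix.mul_assoc, hσ, Matrix.one_mul]
  have hQσ' (A : Matrix m m ℂ) : Q * (σ * A) = -(σ * (Q * A)) := by
    rw [← Matrix.mul_assoc, hQσ, Matrix.neg_mul, Matrix.mul_assoc]
  have hI (A : Matrix m m ℂ) : I • I • A = -A := by rw [smul_smul, I_mul_I, neg_one_smul]
  subst hS' hQN
  simp only [Matrix.mul_assoc, Matrix.mul_add, Matrix.add_mul, Matrix.sub_mul, Matrix.mul_sub,
    Matrix.smul_mul, Matrix.mul_smul, hσ, hσ', hQσ, hQσ', Matrix.mul_neg, Matrix.mul_one,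
    smul_add, smul_sub, smul_neg, hI, mul_smul]
  module

end Dressing

/-- the `N`-fold Darboux transformation maps solutions of the
CNLS Lax pair with potential `Q` to solutions with the new potential `Q^[N]`. -/
theorem darboux_transformation_CNLS
    (N : ℕ)
    (q : ℝ → ℝ → Fin 2 → ℂ)
    (hq : ContDiff ℝ (⊤ : ℕ∞) (fun p : ℝ × ℝ => q p.1 p.2))
    (r : ℝ → ℝ → Fin 2 → ℂ)
    (hr : r = fun x t i => -(starRingEnd ℂ) (q x t i))
    (lam : Fin N → ℂ)
    (hlam_inj : Function.Injective lam)
    (hlam_im : ∀ k, 0 < (lam k).im)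
    (y : Fin N → ℝ → ℝ → Fin 3 → ℂ)
    (hy_smooth : ∀ k, ContDiff ℝ (⊤ : ℕ∞) (fun p : ℝ × ℝ => y k p.1 p.2))
    (hy_x : ∀ k x t, pdxV (y k) x t = (Umat (lam k) (Qmat q r) x t).mulVec (y k x t))
    (hy_t : ∀ k x t, pdtV (y k) x t = (Vcnls (lam k) (Qmat q r) x t).mulVec (y k x t))
    (Mm : ℝ → ℝ → Matrix (Fin N) (Fin N) ℂ)
    (hMm : Mm = fun x t => Matrix.of fun k l =>
      ((lam k - (starRingEnd ℂ) (lam k)) / (lam l - (starRingEnd ℂ) (lam k))) *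
        ∑ i, (starRingEnd ℂ) (y k x t i) * y l x t i)
    (hMm_unit : ∀ x t : ℝ, IsUnit (Mm x t))
    (X : Fin N → ℝ → ℝ → Fin 3 → ℂ)
    (hX : ∀ (x t : ℝ) (i : Fin 3) (k : Fin N),
      y k x t i = ∑ l, X l x t i * Mm x t l k)
    (D : ℂ → ℝ → ℝ → M3)
    (hD : D = fun lam0 x t => (1 : M3) - ∑ k,
      ((lam k - (starRingEnd ℂ) (lam k)) / (lam0 - (starRingEnd ℂ) (lam k))) •
        Matrix.vecMulVec (X k x t) (fun j => (starRingEnd ℂ) (y k x t j)))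
    (QN : ℝ → ℝ → M3)
    (hQN : QN = fun x t => Qmat q r x t + (2 * Complex.I) • (sigma3 *
      ∑ k, (lam k - (starRingEnd ℂ) (lam k)) •
        offdiag (Matrix.vecMulVec (X k x t) (fun j => (starRingEnd ℂ) (y k x t j)))))
    (lam0 : ℂ)
    (hlam0 : ∀ k, lam0 ≠ (starRingEnd ℂ) (lam k))
    (Φ : ℝ → ℝ → M3)
    (hΦ_smooth : ∀ i j : Fin 3, ContDiff ℝ (⊤ : ℕ∞) (fun p : ℝ × ℝ => Φ p.1 p.2 i j))
    (hΦ_x : ∀ x t, pdxM Φ x t = Umat lam0 (Qmat q r) x t * Φ x t)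
    (hΦ_t : ∀ x t, pdtM Φ x t = Vcnls lam0 (Qmat q r) x t * Φ x t) :
    (∀ x t, pdxM (fun x' t' => D lam0 x' t' * Φ x' t') x t
        = Umat lam0 QN x t * (D lam0 x t * Φ x t)) ∧
    (∀ x t, pdtM (fun x' t' => D lam0 x' t' * Φ x' t') x t
        = Vcnls lam0 QN x t * (D lam0 x t * Φ x t)) := by
  set Q := Qmat q r with hQdef
  have hb : ∀ k l, lam l - star (lam k) ≠ 0 := fun k l h => by
    have := congrArg Complex.im h
    simp only [Complex.star_def, Complex.sub_im, Complex.conj_im, Complex.zero_im] at this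
    linarith [hlam_im k, hlam_im l]
  let Y : ℝ → ℝ → Matrix (Fin 3) (Fin N) ℂ := fun x t => Matrix.of fun i k => y k x t i
  let P : ℝ → ℝ → Matrix (Fin 3) (Fin N) ℂ := fun x t =>
    Matrix.of fun i k => X k x t i * (lam k - star (lam k))
  let K : ℝ → ℝ → Matrix (Fin N) (Fin N) ℂ := fun x t =>
    Matrix.of fun k l => ((Y x t)ᴴ * Y x t) k l / (lam l - star (lam k))
  let B : Matrix (Fin N) (Fin N) ℂ := diagonal fun k => star (lam k)
  let L : Matrix (Fin N) (Fin N) ℂ := diagonal lam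
  let R : Matrix (Fin N) (Fin N) ℂ := diagonal fun k => (lam0 - star (lam k))⁻¹
  have hLB : Lᴴ = B := Matrix.diagonal_conjTranspose lam
  have hBR : B * R = lam0 • R - 1 := by
    simp only [B, R, Matrix.diagonal_mul_diagonal, ← Matrix.diagonal_one, ← Matrix.diagonal_smul,
      Matrix.diagonal_sub]
    congr 1
    funext k
    have := sub_ne_zero.2 (hlam0 k)
    simp only [Pi.smul_apply, smul_eq_mul, Complex.star_def]
    field_simp
    ring
  have hRB : R * B = lam0 • R - 1 := by
    rw [← hBR]
    exact (Matrix.commute_diagonal _ _).eq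
  have hMK : ∀ x t, Mm x t = diagonal (fun k => lam k - star (lam k)) * K x t := by
    intro x t
    ext k l
    rw [Matrix.diagonal_mul]
    simp only [hMm, Matrix.of_apply, K, Y, Matrix.mul_apply, Matrix.conjTranspose_apply, Complex.star_def]
    ring
  have hKu : ∀ x t, IsUnit (K x t) := by
    intro x t
    have h := (Matrix.isUnit_iff_isUnit_det _).1 (hMm_unit x t)
    rw [hMK, Matrix.det_mul] at h
    exact (Matrix.isUnit_iff_isUnit_det _).2 (isUnit_of_mul_isUnit_right h)
  have hYP : ∀ x t, Y x t = P x t * K x t := by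
    intro x t
    ext i k
    simp only [Y, P, Matrix.of_apply, hX, Matrix.mul_apply (M := Matrix.of _)]
    refine Finset.sum_congr rfl fun l _ => ?_
    rw [hMK, Matrix.diagonal_mul]
    ring
  have hKs : ∀ x t, K x t * L - B * K x t = (Y x t)ᴴ * Y x t := by
    intro x t
    ext k l
    have := hb k l
    simp only [B, L, Matrix.sub_apply, Matrix.mul_diagonal, Matrix.diagonal_mul]
    simp only [K, Matrix.of_apply]
    field_simp
  have hDm : ∀ x t, D lam0 x t = 1 - P x t * R * (Y x t)ᴴ := by
    intro x t
    ext i j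
    simp only [hD, Matrix.sub_apply, Matrix.sum_apply, Matrix.smul_apply, Matrix.vecMulVec_apply,
      smul_eq_mul, Matrix.mul_apply (N := (Y x t)ᴴ), R, Matrix.mul_diagonal, P, Y, Matrix.of_apply,
      Matrix.conjTranspose_apply, Complex.star_def]
    congr 1
    exact Finset.sum_congr rfl fun k _ => by ring
  have hPY : ∀ x t, P x t * (Y x t)ᴴ = ∑ k, (lam k - (starRingEnd ℂ) (lam k)) •
      Matrix.vecMulVec (X k x t) (fun j => (starRingEnd ℂ) (y k x t j)) := by
    intro x t
    ext i j
    simp only [Matrix.sum_apply, Matrix.smul_apply, Matrix.vecMulVec_apply,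
      smul_eq_mul, Matrix.mul_apply, P, Y, Matrix.of_apply,
      Matrix.conjTranspose_apply, Complex.star_def]
    exact Finset.sum_congr rfl fun k _ => by ring
  have hσ : sigma3 * sigma3 = 1 := by
    ext i j
    fin_cases i <;> fin_cases j <;> simp [sigma3]
  have hσh : sigma3ᴴ = sigma3 := by
    ext i j
    fin_cases i <;> fin_cases j <;> simp [sigma3]
  have hQNm : ∀ x t, QN x t = Q x t +
      I • (sigma3 * (P x t * (Y x t)ᴴ) - P x t * (Y x t)ᴴ * sigma3) := by
    intro x t
    have : ∑ k, (lam k - (starRingEnd ℂ) (lam k)) • offdiag (Matrix.vecMulVec (X k x t)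
        (fun j => (starRingEnd ℂ) (y k x t j))) = offdiag (P x t * (Y x t)ᴴ) := by
      simp only [hPY, offdiag, Finset.mul_sum, Finset.sum_mul, ← Finset.sum_sub_distrib,
        Finset.smul_sum, Matrix.mul_smul, Matrix.smul_mul, smul_sub]
      exact Finset.sum_congr rfl fun k _ => by module
    have hσ' (A : M3) : sigma3 * (sigma3 * A) = A := by rw [← Matrix.mul_assoc, hσ, Matrix.one_mul]
    simp only [hQN, this]
    simp only [offdiag, Matrix.mul_smul, Matrix.mul_sub, Matrix.mul_assoc, hσ']
    module
  have hQh : ∀ x t, (Q x t)ᴴ = -Q x t := by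
    intro x t
    ext i j
    fin_cases i <;> fin_cases j <;> simp [hQdef, Qmat, hr]
  have hQσ : ∀ x t, Q x t * sigma3 = -(sigma3 * Q x t) := by
    intro x t
    ext i j
    fin_cases i <;> fin_cases j <;> simp [hQdef, Qmat, sigma3]
  have hQd : ∀ x t, HasEntryDeriv (fun x => Q x t) (pdxM Q x t) x := by
    intro x t i j
    have hq' : ∀ k, DifferentiableAt ℝ (fun x => q x t k) x := by
      intro k
      have h1 : Differentiable ℝ (fun p : ℝ × ℝ => q p.1 p.2) := hq.differentiable (by simp)
      have h2 : Differentiable ℝ (fun x : ℝ => q x t) :=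
        h1.comp (g := fun p : ℝ × ℝ => q p.1 p.2) (f := fun x : ℝ => (x, t)) (by fun_prop)
      exact (differentiableAt_pi.1 (h2 x)) k
    have hr' : ∀ k, DifferentiableAt ℝ (fun x => r x t k) x := by
      intro k
      rw [hr]
      exact (hq' k).star.neg
    refine DifferentiableAt.hasDerivAt ?_
    fin_cases i <;> fin_cases j <;>
      first
        | exact hq' 0
        | exact hq' 1
        | exact hr' 0
        | exact hr' 1
        | exact differentiableAt_const _
  have hQxh : ∀ x t, (pdxM Q x t)ᴴ = -pdxM Q x t := by
    intro x t
    have h := (hQd x t).conjTranspose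
    simp only [hQh] at h
    refine h.unique ?_
    simpa using (hQd x t).const_smul (-1)
  have hQxσ : ∀ x t, pdxM Q x t * sigma3 = -(sigma3 * pdxM Q x t) := by
    intro x t
    have h := (hQd x t).mul (HasEntryDeriv.const sigma3 x)
    have h' := ((HasEntryDeriv.const sigma3 x).mul (hQd x t)).const_smul (-1)
    simp only [hQσ, neg_one_smul] at h h'
    simpa using h.unique h'
  let V : ℝ → ℝ → M3 := fun x t => I • (sigma3 * (Q x t * Q x t - pdxM Q x t))
  have hVh : ∀ x t, (V x t)ᴴ = -V x t := by
    intro x t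
    simp only [V, Matrix.conjTranspose_smul, Matrix.conjTranspose_mul, Matrix.conjTranspose_sub,
      hσh, hQh, hQxh, Complex.star_def, Complex.conj_I, Matrix.neg_mul,
      Matrix.mul_neg, hQxσ, Matrix.mul_assoc, hQσ, Matrix.mul_sub]
    rw [← Matrix.mul_assoc (Q x t) sigma3, hQσ]
    simp only [Matrix.neg_mul, Matrix.mul_assoc]
    module
  have hyd : ∀ k i, ContDiff ℝ (⊤ : ℕ∞) (fun p : ℝ × ℝ => y k p.1 p.2 i) := fun k i =>
    contDiff_pi.1 (hy_smooth k) i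
  have hYx : ∀ x t, HasEntryDeriv (fun x => Y x t)
      (I • (sigma3 * Y x t * L) + Q x t * Y x t) x := by
    intro x t i k
    have h1 : DifferentiableAt ℝ (fun x => y k x t i) x :=
      (((hyd k i).differentiable (by simp)).comp
        (g := fun p : ℝ × ℝ => y k p.1 p.2 i) (f := fun x : ℝ => (x, t)) (by fun_prop)) x
    refine h1.hasDerivAt.congr_deriv ((congrFun (hy_x k x t) i).trans ?_)
    simp only [Umat, Matrix.add_mulVec, Matrix.smul_mulVec, Matrix.add_apply, Pi.add_apply,
      Pi.smul_apply, Matrix.smul_apply, L, Matrix.mul_diagonal, smul_eq_mul]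
    simp only [Matrix.mul_apply, Matrix.mulVec, dotProduct, Y, Matrix.of_apply]
    ring
  have hYt : ∀ x t, HasEntryDeriv (fun t => Y x t)
      ((2 * I) • (sigma3 * Y x t * L * L) + (2 : ℂ) • (Q x t * Y x t * L) + V x t * Y x t) t := by
    intro x t i k
    have h1 : DifferentiableAt ℝ (fun t => y k x t i) t :=
      (((hyd k i).differentiable (by simp)).comp
        (g := fun p : ℝ × ℝ => y k p.1 p.2 i) (f := fun t : ℝ => (x, t)) (by fun_prop)) t
    refine h1.hasDerivAt.congr_deriv ((congrFun (hy_t k x t) i).trans ?_)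
    change (((2 * I * lam k ^ 2) • sigma3 + (2 * lam k) • Q x t + V x t) *ᵥ y k x t) i = _
    simp only [Matrix.add_mulVec, Matrix.smul_mulVec, Matrix.add_apply, Pi.add_apply,
      Pi.smul_apply, Matrix.smul_apply, L, Matrix.mul_diagonal, smul_eq_mul]
    simp only [Matrix.mul_apply, Matrix.mulVec, dotProduct, Y, Matrix.of_apply]
    ring
  have hYxh : ∀ x t, (I • (sigma3 * Y x t * L) + Q x t * Y x t)ᴴ =
      -(I • (B * (Y x t)ᴴ * sigma3) + (Y x t)ᴴ * Q x t) := by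
    intro x t
    simp only [Matrix.conjTranspose_add, Matrix.conjTranspose_smul, Matrix.conjTranspose_mul, hLB,
      hσh, hQh, Complex.star_def, Complex.conj_I, Matrix.mul_neg, Matrix.mul_assoc]
    module
  have hYth : ∀ x t, ((2 * I) • (sigma3 * Y x t * L * L) + (2 : ℂ) • (Q x t * Y x t * L) +
      V x t * Y x t)ᴴ = -((2 * I) • (B * B * (Y x t)ᴴ * sigma3) +
        (2 : ℂ) • (B * (Y x t)ᴴ * Q x t) + (Y x t)ᴴ * V x t) := by
    intro x t
    simp only [Matrix.conjTranspose_add, Matrix.conjTranspose_smul, Matrix.conjTranspose_mul, hLB,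
      hσh, hQh, hVh, Complex.star_def, map_mul, map_ofNat, Complex.conj_I, Matrix.mul_neg,
      Matrix.mul_assoc]
    module
  have hKx : ∀ x t, HasEntryDeriv (fun x => K x t) (I • ((Y x t)ᴴ * sigma3 * Y x t)) x := by
    intro x t
    refine ((hYx x t).conjTranspose.mul (hYx x t)).sylvester hb (fun x => hKs x t) ?_
    rw [hYxh]
    simp only [Matrix.neg_mul, Matrix.add_mul, Matrix.mul_add, Matrix.smul_mul, Matrix.mul_smul,
      Matrix.mul_assoc, L, B]
    module
  have hKt : ∀ x t, HasEntryDeriv (fun t => K x t)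
      ((2 * I) • ((Y x t)ᴴ * sigma3 * Y x t * L) + (2 * I) • (B * (Y x t)ᴴ * sigma3 * Y x t) +
        (2 : ℂ) • ((Y x t)ᴴ * Q x t * Y x t)) t := by
    intro x t
    refine ((hYt x t).conjTranspose.mul (hYt x t)).sylvester hb (fun t => hKs x t) ?_
    rw [hYth]
    simp only [Matrix.neg_mul, Matrix.add_mul, Matrix.mul_add, Matrix.smul_mul, Matrix.mul_smul,
      Matrix.mul_assoc, L, B]
    module
  have hPx : ∀ x t, HasEntryDeriv (fun x => P x t)
      (I • (sigma3 * P x t * B) + QN x t * P x t) x := by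
    intro x t
    obtain ⟨P', hP', h⟩ := (hYx x t).exists_of_mul_right (hKx x t) (fun x => hKu x t)
      (fun x => hYP x t)
    rwa [dressing_spatial (hKu x t) (hYP x t) (hKs x t) (hQNm x t) h] at hP'
  have hSx : ∀ x t, HasEntryDeriv (fun x => P x t * (Y x t)ᴴ)
      (QN x t * (P x t * (Y x t)ᴴ) - P x t * (Y x t)ᴴ * Q x t +
        I • (sigma3 * (P x t * B * (Y x t)ᴴ) - P x t * B * (Y x t)ᴴ * sigma3)) x := by
    intro x t
    convert (hPx x t).mul (hYx x t).conjTranspose using 1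
    rw [hYxh]
    simp only [Matrix.mul_neg, Matrix.add_mul, Matrix.mul_add, Matrix.smul_mul, Matrix.mul_smul,
      Matrix.mul_assoc]
    module
  have hQNx : ∀ x t, pdxM QN x t = pdxM Q x t + I • (sigma3 *
      (QN x t * (P x t * (Y x t)ᴴ) - P x t * (Y x t)ᴴ * Q x t +
        I • (sigma3 * (P x t * B * (Y x t)ᴴ) - P x t * B * (Y x t)ᴴ * sigma3)) -
      (QN x t * (P x t * (Y x t)ᴴ) - P x t * (Y x t)ᴴ * Q x t +
        I • (sigma3 * (P x t * B * (Y x t)ᴴ) - P x t * B * (Y x t)ᴴ * sigma3)) * sigma3) := by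
    intro x t
    refine HasEntryDeriv.of_deriv_eq (F := fun x => QN x t) ?_
    simp only [fun x => hQNm x t]
    have h := (hQd x t).add ((((HasEntryDeriv.const sigma3 x).mul (hSx x t)).sub
      ((hSx x t).mul (HasEntryDeriv.const sigma3 x))).const_smul I)
    simpa only [← hQNm, Matrix.zero_mul, Matrix.mul_zero, zero_add, add_zero] using h
  have hW : ∀ x t, I • (sigma3 * (QN x t * QN x t - pdxM QN x t)) =
      V x t + (2 : ℂ) • (QN x t * (P x t * (Y x t)ᴴ) - P x t * (Y x t)ᴴ * Q x t) +
        (2 * I) • (sigma3 * (P x t * B * (Y x t)ᴴ) - P x t * B * (Y x t)ᴴ * sigma3) := by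
    intro x t
    rw [hQNx]
    exact dressed_temporal_coeff hσ (hQσ x t) (hQNm x t) rfl
  have hPt : ∀ x t, HasEntryDeriv (fun t => P x t)
      ((2 * I) • (sigma3 * P x t * B * B) + (2 : ℂ) • (QN x t * P x t * B) +
        I • (sigma3 * (QN x t * QN x t - pdxM QN x t)) * P x t) t := by
    intro x t
    obtain ⟨P', hP', h⟩ := (hYt x t).exists_of_mul_right (hKt x t) (fun t => hKu x t)
      (fun t => hYP x t)
    rw [hW]
    rwa [dressing_temporal (hKu x t) (hYP x t) (hKs x t) (hQNm x t) h] at hP'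
  have hD' {P Y : ℝ → Matrix (Fin 3) (Fin N) ℂ} {P' Y' : Matrix (Fin 3) (Fin N) ℂ} {s : ℝ}
      (hP : HasEntryDeriv P P' s) (hY : HasEntryDeriv Y Y' s) :
      HasEntryDeriv (fun s => 1 - P s * R * (Y s)ᴴ) (-(P' * R * (Y s)ᴴ + P s * R * Y'ᴴ)) s := by
    simpa using (HasEntryDeriv.const 1 s).sub ((hP.mul (HasEntryDeriv.const R s)).mul
      hY.conjTranspose)
  refine ⟨fun x t => ?_, fun x t => ?_⟩
  · have hΦ : HasEntryDeriv (fun x => Φ x t) (Umat lam0 Q x t * Φ x t) x := by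
      rw [← hΦ_x]
      exact fun i j => DifferentiableAt.hasDerivAt ((((hΦ_smooth i j).differentiable (by simp)).comp
        (g := fun p : ℝ × ℝ => Φ p.1 p.2 i j) (f := fun x : ℝ => (x, t)) (by fun_prop)) x)
    refine HasEntryDeriv.of_deriv_eq (F := fun x => D lam0 x t * Φ x t) ?_
    have h := (hD' (hPx x t) (hYx x t)).mul hΦ
    rw [hYxh, Matrix.mul_neg, ← sub_eq_add_neg, darboux_spatial hBR hRB (hQNm x t)] at h
    simp only [hDm]
    convert h using 1
    simp only [Umat, Matrix.sub_mul, Matrix.mul_assoc, sub_add_cancel]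
  · have hΦ : HasEntryDeriv (fun t => Φ x t) (Vcnls lam0 Q x t * Φ x t) t := by
      rw [← hΦ_t]
      exact fun i j => DifferentiableAt.hasDerivAt ((((hΦ_smooth i j).differentiable (by simp)).comp
        (g := fun p : ℝ × ℝ => Φ p.1 p.2 i j) (f := fun t : ℝ => (x, t)) (by fun_prop)) t)
    refine HasEntryDeriv.of_deriv_eq (F := fun t => D lam0 x t * Φ x t) ?_
    have h := (hD' (hPt x t) (hYt x t)).mul hΦ
    rw [hYth, Matrix.mul_neg, ← sub_eq_add_neg, darboux_temporal hBR hRB (hQNm x t) (hW x t)] at h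
    simp only [hDm]
    convert h using 1
    simp only [Vcnls, V, Matrix.sub_mul, Matrix.mul_assoc, sub_add_cancel]
end
end

section
/- Let q = (q₁,q₂) : ℝ × ℝ → ℝ² be smooth, set r = (−q₁, −q₂), and form U(λ) = iλσ₃ + Q and V_CmKdV(λ) = 4iλ³σ₃ + 4λ²Q + 2iλσ₃(Q² − ∂_xQ) − Q(∂_xQ) + (∂_xQ)Q − ∂_x²Q + 2Q³. Then the zero-curvature equation ∂_t U(λ) − ∂_x V_CmKdV(λ) + U(λ)V_CmKdV(λ) − V_CmKdV(λ)U(λ) = 0 holds at every (x,t) for every λ ∈ ℂ if and only if q solves the CmKdV system. -/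
open Matrix Complex

noncomputable section

/-- Partial derivative in the first (spatial) variable, for scalar functions. -/
def pdx {E : Type*} [NormedAddCommGroup E] [NormedSpace ℝ E]
    (f : ℝ → ℝ → E) : ℝ → ℝ → E := fun x t => deriv (fun x' => f x' t) x

/-- Partial derivative in the second (time) variable, for scalar functions. -/
def pdt {E : Type*} [NormedAddCommGroup E] [NormedSpace ℝ E]
    (f : ℝ → ℝ → E) : ℝ → ℝ → E := fun x t => deriv (fun t' => f x t') t

/-- The CmKdV temporal Lax matrix
`V = 4iλ³σ₃ + 4λ²Q + 2iλσ₃(Q² − Q_x) − QQ_x + Q_xQ − Q_xx + 2Q³`. -/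
def Vcmkdv (lam : ℂ) (Q : ℝ → ℝ → M3) : ℝ → ℝ → M3 :=
  fun x t => (4 * Complex.I * lam ^ 3) • sigma3 + (4 * lam ^ 2) • Q x t
    + (2 * Complex.I * lam) • (sigma3 * (Q x t * Q x t - pdxM Q x t))
    - Q x t * pdxM Q x t + pdxM Q x t * Q x t
    - pdxM (pdxM Q) x t + (2 : ℂ) • (Q x t * Q x t * Q x t)

/-- The CmKdV system for a real two-component potential. -/
def CmKdV (q : ℝ → ℝ → Fin 2 → ℝ) : Prop :=
  ∀ x t : ℝ,
    (pdt (fun x t => q x t 0) x t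
      + pdx (pdx (pdx (fun x t => q x t 0))) x t
      + 6 * (q x t 0) ^ 2 * pdx (fun x t => q x t 0) x t
      + 3 * q x t 1 * pdx (fun x t => q x t 0 * q x t 1) x t = 0) ∧
    (pdt (fun x t => q x t 1) x t
      + pdx (pdx (pdx (fun x t => q x t 1))) x t
      + 6 * (q x t 1) ^ 2 * pdx (fun x t => q x t 1) x t
      + 3 * q x t 0 * pdx (fun x t => q x t 0 * q x t 1) x t = 0)

/-- Entrywise differentiability of a matrix-valued curve, with prescribed derivative. -/
def HasEntrywiseDerivAt (F : ℝ → M3) (F' : M3) (x : ℝ) : Prop :=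
  ∀ i j, HasDerivAt (fun y => F y i j) (F' i j) x

namespace HasEntrywiseDerivAt

variable {F G : ℝ → M3} {F' G' : M3} {x : ℝ}

theorem const (A : M3) : HasEntrywiseDerivAt (fun _ => A) 0 x :=
  fun i j => hasDerivAt_const x (A i j)

theorem add (hF : HasEntrywiseDerivAt F F' x) (hG : HasEntrywiseDerivAt G G' x) :
    HasEntrywiseDerivAt (fun y => F y + G y) (F' + G') x :=
  fun i j => (hF i j).add (hG i j)

theorem sub (hF : HasEntrywiseDerivAt F F' x) (hG : HasEntrywiseDerivAt G G' x) :
    HasEntrywiseDerivAt (fun y => F y - G y) (F' - G') x :=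
  fun i j => (hF i j).sub (hG i j)

theorem smul (c : ℂ) (hF : HasEntrywiseDerivAt F F' x) :
    HasEntrywiseDerivAt (fun y => c • F y) (c • F') x :=
  fun i j => (hF i j).const_mul c

theorem mul (hF : HasEntrywiseDerivAt F F' x) (hG : HasEntrywiseDerivAt G G' x) :
    HasEntrywiseDerivAt (fun y => F y * G y) (F' * G x + F x * G') x := by
  intro i j
  simp only [Matrix.mul_apply, Matrix.add_apply, ← Finset.sum_add_distrib]
  exact HasDerivAt.fun_sum fun k _ => (hF i k).mul (hG k j)

end HasEntrywiseDerivAt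

theorem pdxM_eq {F : ℝ → ℝ → M3} {F' : M3} {x t : ℝ}
    (h : HasEntrywiseDerivAt (fun y => F y t) F' x) : pdxM F x t = F' :=
  Matrix.ext fun i j => (h i j).deriv

theorem pdtM_eq {F : ℝ → ℝ → M3} {F' : M3} {x t : ℝ}
    (h : HasEntrywiseDerivAt (F x) F' t) : pdtM F x t = F' :=
  Matrix.ext fun i j => (h i j).deriv

/-- The potential matrix with first column `(0, a, b)` and first row `(0, -a, -b)`. -/
def potential (a b : ℝ) : M3 :=
  !![0, -(a : ℂ), -(b : ℂ); (a : ℂ), 0, 0; (b : ℂ), 0, 0]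

theorem hasEntrywiseDerivAt_potential {a b : ℝ → ℝ} {a' b' x : ℝ}
    (ha : HasDerivAt a a' x) (hb : HasDerivAt b b' x) :
    HasEntrywiseDerivAt (fun y => potential (a y) (b y)) (potential a' b') x := by
  intro i j
  have h0 := hasDerivAt_const x (0 : ℂ)
  fin_cases i <;> fin_cases j <;>
    first
    | exact h0
    | exact ha.ofReal_comp
    | exact hb.ofReal_comp
    | exact ha.ofReal_comp.neg
    | exact hb.ofReal_comp.neg

/-- The `x`-derivative of `Vcmkdv`, when `Q` is three times differentiable in `x`. -/
theorem pdxM_Vcmkdv {lam : ℂ} {Q Q₁ Q₂ : ℝ → ℝ → M3} {Q₃ : M3} {x t : ℝ}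
    (h₁ : ∀ x t, HasEntrywiseDerivAt (fun y => Q y t) (Q₁ x t) x)
    (h₂ : ∀ x t, HasEntrywiseDerivAt (fun y => Q₁ y t) (Q₂ x t) x)
    (h₃ : HasEntrywiseDerivAt (fun y => Q₂ y t) Q₃ x) :
    pdxM (Vcmkdv lam Q) x t =
      (4 * lam ^ 2) • Q₁ x t
        + (2 * Complex.I * lam) • (sigma3 * (Q₁ x t * Q x t + Q x t * Q₁ x t - Q₂ x t))
        - Q x t * Q₂ x t + Q₂ x t * Q x t - Q₃
        + (2 : ℂ) • ((Q₁ x t * Q x t + Q x t * Q₁ x t) * Q x t + Q x t * Q x t * Q₁ x t) := by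
  have e₁ : pdxM Q = Q₁ := funext₂ fun x t => pdxM_eq (h₁ x t)
  have e₂ : pdxM Q₁ = Q₂ := funext₂ fun x t => pdxM_eq (h₂ x t)
  have d₁ := h₁ x t
  have d₂ := h₂ x t
  unfold Vcmkdv
  rw [e₁, e₂]
  refine (pdxM_eq ((((((HasEntrywiseDerivAt.const _).add (d₁.smul _)).add
    (((HasEntrywiseDerivAt.const _).mul ((d₁.mul d₁).sub d₂)).smul _)).sub
    (d₁.mul d₂)).add (d₂.mul d₁)).sub h₃ |>.add (((d₁.mul d₁).mul d₁).smul _))).trans ?_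
  simp only [zero_add, zero_mul]
  abel

/-- If `σ² = 1` and `σ` anticommutes with `Q` and its derivatives, then the zero-curvature
expression does not depend on the spectral parameter. -/
theorem zero_curvature_algebra {A : Type*} [Ring A] [Algebra ℂ A] (lam : ℂ)
    {σ Q Q₁ Q₂ : A} (Q₃ S : A) (hσ : σ * σ = 1) (h : Q * σ = -(σ * Q))
    (h₁ : Q₁ * σ = -(σ * Q₁)) (h₂ : Q₂ * σ = -(σ * Q₂)) :
    let U := (Complex.I * lam) • σ + Q
    let V := (4 * Complex.I * lam ^ 3) • σ + (4 * lam ^ 2) • Q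
      + (2 * Complex.I * lam) • (σ * (Q * Q - Q₁)) - Q * Q₁ + Q₁ * Q - Q₂
      + (2 : ℂ) • (Q * Q * Q)
    S - ((4 * lam ^ 2) • Q₁
        + (2 * Complex.I * lam) • (σ * (Q₁ * Q + Q * Q₁ - Q₂))
        - Q * Q₂ + Q₂ * Q - Q₃
        + (2 : ℂ) • ((Q₁ * Q + Q * Q₁) * Q + Q * Q * Q₁)) + U * V - V * U =
      S + Q₃ - (3 : ℂ) • (Q₁ * Q * Q + Q * Q * Q₁) := by
  obtain ⟨m, rfl⟩ : ∃ m, lam = -Complex.I * m :=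
    ⟨Complex.I * lam, by linear_combination lam * Complex.I_mul_I⟩
  have c₁ : Complex.I * (-Complex.I * m) = m := by linear_combination -m * Complex.I_sq
  have c₂ : 4 * (-Complex.I * m) ^ 2 = -4 * m ^ 2 := by
    linear_combination 4 * m ^ 2 * Complex.I_sq
  have c₃ : 4 * Complex.I * (-Complex.I * m) ^ 3 = -4 * m ^ 3 := by
    linear_combination (-4 * m ^ 3) * (Complex.I ^ 2 - 1) * Complex.I_sq
  have c₄ : 2 * Complex.I * (-Complex.I * m) = 2 * m := by
    linear_combination -2 * m * Complex.I_sq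
  have hσ' : ∀ X, σ * (σ * X) = X := fun X => by rw [← mul_assoc, hσ, one_mul]
  have h' : ∀ X, Q * (σ * X) = -(σ * (Q * X)) := fun X => by
    rw [← mul_assoc, h, neg_mul, mul_assoc]
  have h₁' : ∀ X, Q₁ * (σ * X) = -(σ * (Q₁ * X)) := fun X => by
    rw [← mul_assoc, h₁, neg_mul, mul_assoc]
  simp only [c₁, c₂, c₃, c₄]
  simp only [mul_add, add_mul, mul_sub, sub_mul, smul_mul_assoc,
    mul_smul_comm, mul_assoc, mul_neg, neg_mul, hσ, hσ', h, h', h₁, h₁', h₂, neg_neg]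
  module

theorem potential_mul_sigma3 (a b : ℝ) :
    potential a b * sigma3 = -(sigma3 * potential a b) := by
  ext i j
  fin_cases i <;> fin_cases j <;> simp [potential, sigma3]

theorem CmKdV_potential (a b a₁ b₁ a₃ b₃ s r : ℝ) :
    let Q := potential a b
    let Q₁ := potential a₁ b₁
    potential s r + potential a₃ b₃ - (3 : ℂ) • (Q₁ * Q * Q + Q * Q * Q₁) =
      potential (s + a₃ + 6 * a ^ 2 * a₁ + 3 * b * (a₁ * b + a * b₁))
        (r + b₃ + 6 * b ^ 2 * b₁ + 3 * a * (a₁ * b + a * b₁)) := by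
  ext i j
  fin_cases i <;> fin_cases j <;>
    simp [potential] <;> ring

theorem sigma3_mul_self : sigma3 * sigma3 = 1 := by
  ext i j
  fin_cases i <;> fin_cases j <;> simp [sigma3]

theorem potential_eq_zero_iff {a b : ℝ} : potential a b = 0 ↔ a = 0 ∧ b = 0 := by
  constructor
  · intro h
    have h₁ := congrFun (congrFun h 1) 0
    have h₂ := congrFun (congrFun h 2) 0
    simp [potential] at h₁ h₂
    exact ⟨h₁, h₂⟩
  · rintro ⟨rfl, rfl⟩
    ext i j
    fin_cases i <;> fin_cases j <;> simp [potential]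

theorem contDiff_pdx {f : ℝ → ℝ → ℝ} (hf : ∀ t, ContDiff ℝ (⊤ : ℕ∞) fun x => f x t) (t : ℝ) :
    ContDiff ℝ (⊤ : ℕ∞) fun x => pdx f x t :=
  (contDiff_infty_iff_deriv.mp (hf t)).2

theorem hasDerivAt_pdx {f : ℝ → ℝ → ℝ} (hf : ∀ t, ContDiff ℝ (⊤ : ℕ∞) fun x => f x t)
    (x t : ℝ) : HasDerivAt (fun y => f y t) (pdx f x t) x :=
  ((hf t).differentiable (by simp) x).hasDerivAt

/-- the zero-curvature equation for `(U, V_CmKdV)` holds for all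
spectral parameters iff the real potential `q` solves the CmKdV system. -/
theorem zero_curvature_iff_CmKdV
    (q : ℝ → ℝ → Fin 2 → ℝ)
    (hq : ContDiff ℝ (⊤ : ℕ∞) (fun p : ℝ × ℝ => q p.1 p.2))
    (Q : ℝ → ℝ → M3)
    (hQ : Q = fun x t =>
      !![0, -((q x t 0 : ℝ) : ℂ), -((q x t 1 : ℝ) : ℂ);
         ((q x t 0 : ℝ) : ℂ), 0, 0;
         ((q x t 1 : ℝ) : ℂ), 0, 0]) :
    (∀ (lam : ℂ) (x t : ℝ),
      pdtM (Umat lam Q) x t - pdxM (Vcmkdv lam Q) x t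
        + Umat lam Q x t * Vcmkdv lam Q x t
        - Vcmkdv lam Q x t * Umat lam Q x t = 0)
    ↔ CmKdV q := by
  subst hQ
  have hs : ∀ i, ContDiff ℝ (⊤ : ℕ∞) fun p : ℝ × ℝ => q p.1 p.2 i := contDiff_pi.mp hq
  have hx : ∀ i t, ContDiff ℝ (⊤ : ℕ∞) fun x => q x t i := fun i t =>
    (hs i).comp (contDiff_id.prodMk contDiff_const : ContDiff ℝ _ fun x : ℝ => (x, t))
  have ht : ∀ i x t, HasDerivAt (fun s => q x s i) (pdt (fun x t => q x t i) x t) t :=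
    fun i x t => (((hs i).comp (contDiff_const.prodMk contDiff_id :
      ContDiff ℝ _ fun s : ℝ => (x, s))).differentiable (by simp) t).hasDerivAt
  have hx₁ := fun i => contDiff_pdx (hx i)
  have hx₂ := fun i => contDiff_pdx (hx₁ i)
  have h₁ := fun x t => hasEntrywiseDerivAt_potential
    (hasDerivAt_pdx (hx 0) x t) (hasDerivAt_pdx (hx 1) x t)
  have h₂ := fun x t => hasEntrywiseDerivAt_potential
    (hasDerivAt_pdx (hx₁ 0) x t) (hasDerivAt_pdx (hx₁ 1) x t)
  have h₃ := fun x t => hasEntrywiseDerivAt_potential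
    (hasDerivAt_pdx (hx₂ 0) x t) (hasDerivAt_pdx (hx₂ 1) x t)
  have hprod : ∀ x t, pdx (fun x t => q x t 0 * q x t 1) x t =
      pdx (fun x t => q x t 0) x t * q x t 1 + q x t 0 * pdx (fun x t => q x t 1) x t :=
    fun x t => ((hasDerivAt_pdx (hx 0) x t).mul (hasDerivAt_pdx (hx 1) x t)).deriv
  change (∀ (lam : ℂ) (x t : ℝ),
    pdtM (Umat lam fun x t => potential (q x t 0) (q x t 1)) x t
      - pdxM (Vcmkdv lam fun x t => potential (q x t 0) (q x t 1)) x t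
      + Umat lam (fun x t => potential (q x t 0) (q x t 1)) x t
        * Vcmkdv lam (fun x t => potential (q x t 0) (q x t 1)) x t
      - Vcmkdv lam (fun x t => potential (q x t 0) (q x t 1)) x t
        * Umat lam (fun x t => potential (q x t 0) (q x t 1)) x t = 0) ↔ CmKdV q
  have hU : ∀ (lam : ℂ) (x t : ℝ),
      pdtM (Umat lam fun x t => potential (q x t 0) (q x t 1)) x t =
        potential (pdt (fun x t => q x t 0) x t) (pdt (fun x t => q x t 1) x t) :=
    fun lam x t => (pdtM_eq ((HasEntrywiseDerivAt.const _).add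
      (hasEntrywiseDerivAt_potential (ht 0 x t) (ht 1 x t)))).trans (zero_add _)
  have e₁ := funext₂ fun x t => pdxM_eq (F := fun x t => potential (q x t 0) (q x t 1)) (h₁ x t)
  have e₂ := funext₂ fun x t => pdxM_eq (F := fun x t => potential
    (pdx (fun x t => q x t 0) x t) (pdx (fun x t => q x t 1) x t)) (h₂ x t)
  simp only [hU, pdxM_Vcmkdv h₁ h₂ (h₃ _ _)]
  simp only [Vcmkdv, Umat, e₁, e₂,
    zero_curvature_algebra _ _ _ sigma3_mul_self (potential_mul_sigma3 _ _)
      (potential_mul_sigma3 _ _) (potential_mul_sigma3 _ _),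
    CmKdV_potential, potential_eq_zero_iff, CmKdV, hprod, forall_const]
end
end

section
/- Let a, b, θ₁, x₁ ∈ ℝ with a ≠ 0. Define η(x,t) = 2b(x + 4(3a² − b²)t) + x₁ and χ(x,t) = 2a(x + 4(a² − 3b²)t) + θ₁, and let q(x,t) = 2 ∂_x [ arctan( (b/a) · sin(χ(x,t)) / cosh(η(x,t)) ) ] (the partial derivative in x of the arctan expression). Then q is a smooth solution of the mKdV equation ∂_t q + ∂_x³ q + 6q² ∂_x q = 0 on ℝ × ℝ (the breather solution). -/
noncomputable section

/-- The mKdV equation `q_t + q_xxx + 6 q² q_x = 0`. -/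
def MKdV (q : ℝ → ℝ → ℝ) : Prop :=
  ∀ x t : ℝ,
    pdt q x t + pdx (pdx (pdx q)) x t + 6 * (q x t) ^ 2 * pdx q x t = 0

/-- The numerator of the breather as a function of the two phases. -/
def breatherNum (a b X E : ℝ) : ℝ :=
  4 * a * b * (a * Real.cos X * Real.cosh E - b * Real.sin X * Real.sinh E)

/-- The denominator of the breather as a function of the two phases. -/
def breatherDen (a b X E : ℝ) : ℝ :=
  a ^ 2 * Real.cosh E ^ 2 + b ^ 2 * Real.sin X ^ 2

/-- The numerator of the time derivative of the breather potential
`2 * arctan (b / a * sin X / cosh E)`, whose denominator is `breatherDen`. -/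
def breatherTimeNum (a b X E : ℝ) : ℝ :=
  16 * a * b * (a * (a ^ 2 - 3 * b ^ 2) * Real.cos X * Real.cosh E
    - b * (3 * a ^ 2 - b ^ 2) * Real.sin X * Real.sinh E)

theorem breatherDen_pos {a : ℝ} (ha : a ≠ 0) (b X E : ℝ) : 0 < breatherDen a b X E := by
  have := Real.cosh_pos E
  unfold breatherDen
  positivity

section Deriv

variable {X E : ℝ → ℝ} {p r y : ℝ}

theorem HasDerivAt.breatherNum (a b : ℝ) (hX : HasDerivAt X p y) (hE : HasDerivAt E r y) :
    HasDerivAt (fun y => breatherNum a b (X y) (E y))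
      (4 * a * b * ((a * r - b * p) * Real.cos (X y) * Real.sinh (E y)
        - (a * p + b * r) * Real.sin (X y) * Real.cosh (E y))) y := by
  unfold _root_.breatherNum
  refine ((((hX.cos.const_mul a).mul hE.cosh).sub
    ((hX.sin.const_mul b).mul hE.sinh)).const_mul (4 * a * b)).congr_deriv ?_
  ring

theorem HasDerivAt.breatherDen (a b : ℝ) (hX : HasDerivAt X p y) (hE : HasDerivAt E r y) :
    HasDerivAt (fun y => breatherDen a b (X y) (E y))
      (2 * a ^ 2 * r * Real.cosh (E y) * Real.sinh (E y)
        + 2 * b ^ 2 * p * Real.sin (X y) * Real.cos (X y)) y := by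
  unfold _root_.breatherDen
  refine (((hE.cosh.pow 2).const_mul (a ^ 2)).add ((hX.sin.pow 2).const_mul (b ^ 2))).congr_deriv ?_
  norm_num
  ring

theorem HasDerivAt.breatherTimeNum (a b : ℝ) (hX : HasDerivAt X p y) (hE : HasDerivAt E r y) :
    HasDerivAt (fun y => breatherTimeNum a b (X y) (E y))
      (16 * a * b * (a * (a ^ 2 - 3 * b ^ 2) *
          (r * Real.cos (X y) * Real.sinh (E y) - p * Real.sin (X y) * Real.cosh (E y))
        - b * (3 * a ^ 2 - b ^ 2) *
          (p * Real.cos (X y) * Real.sinh (E y) + r * Real.sin (X y) * Real.cosh (E y)))) y := by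
  unfold _root_.breatherTimeNum
  refine ((((hX.cos.const_mul (a * (a ^ 2 - 3 * b ^ 2))).mul hE.cosh).sub
    ((hX.sin.const_mul (b * (3 * a ^ 2 - b ^ 2))).mul hE.sinh)).const_mul (16 * a * b)).congr_deriv ?_
  ring

theorem HasDerivAt.two_mul_arctan_breather {a : ℝ} (ha : a ≠ 0) (b : ℝ)
    (hX : HasDerivAt X (2 * a) y) (hE : HasDerivAt E (2 * b) y) :
    HasDerivAt (fun y => 2 * Real.arctan (b / a * Real.sin (X y) / Real.cosh (E y)))
      (_root_.breatherNum a b (X y) (E y) / _root_.breatherDen a b (X y) (E y)) y := by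
  have hC := (Real.cosh_pos (E y)).ne'
  have hD := (breatherDen_pos ha b (X y) (E y)).ne'
  have hA : 1 + (b / a * Real.sin (X y) / Real.cosh (E y)) ^ 2 =
      _root_.breatherDen a b (X y) (E y) / (a * Real.cosh (E y)) ^ 2 := by
    unfold _root_.breatherDen
    field_simp
  refine ((((hX.sin.const_mul (b / a)).div hE.cosh hC).arctan).const_mul 2).congr_deriv ?_
  simp only [Pi.div_apply, hA]
  unfold _root_.breatherNum
  field_simp
  ring

end Deriv

/-- The potential mKdV equation for the breather, with denominators cleared, as an identity in
`s = sin χ`, `c = cos χ`, `S = sinh η`, `C = cosh η`. -/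
theorem breather_second_deriv_identity (a b s c S C : ℝ) (h₁ : s ^ 2 + c ^ 2 = 1)
    (h₂ : C ^ 2 - S ^ 2 = 1) :
    let D := a ^ 2 * C ^ 2 + b ^ 2 * s ^ 2
    let N := 4 * a * b * (a * c * C - b * s * S)
    let D' := 4 * a * b * (a * C * S + b * s * c)
    16 * a * b * (a * (a ^ 2 - 3 * b ^ 2) * c * C - b * (3 * a ^ 2 - b ^ 2) * s * S) * D ^ 2
      + (-16 * a * b * (a ^ 2 + b ^ 2) * (a * c * C + b * s * S)) * D ^ 2
      - 2 * (-8 * a * b * (a ^ 2 + b ^ 2) * s * C) * D' * D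
      - N * D * (16 * a ^ 2 * b ^ 2 * (C ^ 2 - s ^ 2)) + 2 * N * D' ^ 2 + 2 * N ^ 3 = 0 := by
  intro D N D'
  grind

/-- the breather is a smooth solution of the mKdV equation. -/
theorem mkdv_breather (a b θ₁ x₁ : ℝ) (ha : a ≠ 0)
    (η χ : ℝ → ℝ → ℝ)
    (hη : η = fun x t => 2 * b * (x + 4 * (3 * a ^ 2 - b ^ 2) * t) + x₁)
    (hχ : χ = fun x t => 2 * a * (x + 4 * (a ^ 2 - 3 * b ^ 2) * t) + θ₁)
    (q : ℝ → ℝ → ℝ)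
    (hq : q = fun x t =>
      2 * pdx (fun x t =>
        Real.arctan ((b / a) * Real.sin (χ x t) / Real.cosh (η x t))) x t) :
    ContDiff ℝ (⊤ : ℕ∞) (fun p : ℝ × ℝ => q p.1 p.2) ∧ MKdV q := by
  have hχx (x t : ℝ) : HasDerivAt (fun x => χ x t) (2 * a) x := by
    subst hχ
    simpa using (((hasDerivAt_id x).add_const (4 * (a ^ 2 - 3 * b ^ 2) * t)).const_mul
      (2 * a)).add_const θ₁
  have hηx (x t : ℝ) : HasDerivAt (fun x => η x t) (2 * b) x := by
    subst hη
    simpa using (((hasDerivAt_id x).add_const (4 * (3 * a ^ 2 - b ^ 2) * t)).const_mul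
      (2 * b)).add_const x₁
  have hχt (x t : ℝ) : HasDerivAt (χ x) (2 * a * (4 * (a ^ 2 - 3 * b ^ 2))) t := by
    subst hχ
    simpa using ((((hasDerivAt_id t).const_mul (4 * (a ^ 2 - 3 * b ^ 2))).const_add x).const_mul
      (2 * a)).add_const θ₁
  have hηt (x t : ℝ) : HasDerivAt (η x) (2 * b * (4 * (3 * a ^ 2 - b ^ 2))) t := by
    subst hη
    simpa using ((((hasDerivAt_id t).const_mul (4 * (3 * a ^ 2 - b ^ 2))).const_add x).const_mul
      (2 * b)).add_const x₁
  have hD (x t : ℝ) : breatherDen a b (χ x t) (η x t) ≠ 0 := (breatherDen_pos ha b _ _).ne'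
  have hq_eq : q = fun x t =>
      breatherNum a b (χ x t) (η x t) / breatherDen a b (χ x t) (η x t) := by
    subst hq
    funext x t
    rw [← ((hχx x t).two_mul_arctan_breather ha b (hηx x t)).deriv, deriv_const_mul_field]
    rfl
  have hqx (x t : ℝ) := ((hχx x t).breatherNum a b (hηx x t)).div
    ((hχx x t).breatherDen a b (hηx x t)) (hD x t)
  have hqt (x t : ℝ) := ((hχt x t).breatherNum a b (hηt x t)).div
    ((hχt x t).breatherDen a b (hηt x t)) (hD x t)
  have hPx (x t : ℝ) := ((hχx x t).breatherTimeNum a b (hηx x t)).div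
    ((hχx x t).breatherDen a b (hηx x t)) (hD x t)
  have hq_x (x t : ℝ) : HasDerivAt (fun x => q x t) (pdx q x t) x := by
    subst hq_eq
    exact (hqx x t).differentiableAt.hasDerivAt
  have hpdx : pdx q = fun x t =>
      (-8 * a * b * (a ^ 2 + b ^ 2) * Real.sin (χ x t) * Real.cosh (η x t)
          * breatherDen a b (χ x t) (η x t)
        - breatherNum a b (χ x t) (η x t) * (4 * a * b * (a * Real.cosh (η x t)
          * Real.sinh (η x t) + b * Real.sin (χ x t) * Real.cos (χ x t))))
        / breatherDen a b (χ x t) (η x t) ^ 2 := by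
    subst hq_eq
    funext x t
    refine (hqx x t).deriv.trans ?_
    ring
  have hpdxx : pdx (pdx q) = fun x t =>
      -(breatherTimeNum a b (χ x t) (η x t) / breatherDen a b (χ x t) (η x t))
        - 2 * q x t ^ 3 := by
    rw [hpdx]
    funext x t
    have hX := hχx x t
    have hE := hηx x t
    have hden := hX.breatherDen a b hE
    have h := ((((hX.sin.const_mul (-8 * a * b * (a ^ 2 + b ^ 2))).mul hE.cosh).mul hden).sub
      ((hX.breatherNum a b hE).mul ((((hE.cosh.const_mul a).mul hE.sinh).add
        ((hX.sin.const_mul b).mul hX.cos)).const_mul (4 * a * b)))).div (hden.pow 2)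
        (pow_ne_zero 2 (hD x t))
    refine h.deriv.trans ?_
    have h₁ := Real.sin_sq_add_cos_sq (χ x t)
    have h₂ := Real.cosh_sq_sub_sinh_sq (η x t)
    have key := breather_second_deriv_identity a b _ _ _ _ h₁ h₂
    have hD' := hD x t
    rw [hq_eq]
    simp only [Pi.mul_apply, Pi.add_apply, Pi.sub_apply, Pi.pow_apply, Nat.cast_ofNat,
      Nat.add_one_sub_one, pow_one]
    generalize hd : breatherDen a b (χ x t) (η x t) = d at *
    generalize hn : breatherNum a b (χ x t) (η x t) = n at *
    generalize hp : breatherTimeNum a b (χ x t) (η x t) = p at *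
    unfold breatherDen at hd
    unfold breatherNum at hn
    unfold breatherTimeNum at hp
    generalize Real.sin (χ x t) = s at *
    generalize Real.cos (χ x t) = c at *
    generalize Real.sinh (η x t) = S at *
    generalize Real.cosh (η x t) = C at *
    simp only [hd, hn, hp] at key
    field_simp
    linear_combination key - 8 * a ^ 2 * b ^ 2 * n * d * (h₁ - h₂)
  refine ⟨?_, fun x t => ?_⟩
  · rw [hq_eq]
    refine ContDiff.div ?_ ?_ fun p => hD p.1 p.2
    · subst hη hχ
      unfold breatherNum
      fun_prop
    · subst hη hχ
      unfold breatherDen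
      fun_prop
  · have hpdt : pdt q x t = deriv (fun x =>
        breatherTimeNum a b (χ x t) (η x t) / breatherDen a b (χ x t) (η x t)) x := by
      rw [hq_eq]
      refine (hqt x t).deriv.trans (Eq.trans ?_ (hPx x t).deriv.symm)
      congr 1
      unfold breatherNum breatherDen breatherTimeNum
      ring
    have hpdxxx : pdx (pdx (pdx q)) x t = -deriv (fun x =>
        breatherTimeNum a b (χ x t) (η x t) / breatherDen a b (χ x t) (η x t)) x
          - 6 * q x t ^ 2 * pdx q x t := by
      rw [hpdxx]
      refine (((hPx x t).differentiableAt.hasDerivAt.neg).sub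
        (((hq_x x t).pow 3).const_mul 2)).deriv.trans ?_
      norm_num
      congr 1
      ring
    rw [hpdt, hpdxxx]
    ring
end
end

section
/- Let b₁, b₂ > 0 with b₁ ≠ b₂, and x₁, x₂ ∈ ℝ. Set B = (b₁ − b₂)/(b₁ + b₂), ξ_k(x,t) = 2b_k(x − 4b_k²t) + x_k for k = 1,2, N(x,t) = e^{ξ₁} + e^{ξ₂}, and D(x,t) = 1 − B² e^{ξ₁+ξ₂}. Then the function q(x,t) = 2 · ( (∂_x N) D − N (∂_x D) ) / ( D² + N² ) is a smooth solution of the mKdV equation on ℝ × ℝ (the 2-soliton solution; wherever D ≠ 0 it equals 2 ∂_x arctan(N/D)). -/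
noncomputable section

/-- If `N + i D` solves the bilinear (Hirota) form of the mKdV equation and `D² + N²` does not
vanish, then `2 (N_x D - N D_x) / (D² + N²)` solves the mKdV equation. -/
theorem mkdv_of_bilinear {N D N₁ N₂ N₃ D₁ D₂ D₃ Nt Dt Nxt Dxt : ℝ → ℝ → ℝ}
    (hN : ∀ x t, HasDerivAt (fun y => N y t) (N₁ x t) x)
    (hN₁ : ∀ x t, HasDerivAt (fun y => N₁ y t) (N₂ x t) x)
    (hN₂ : ∀ x t, HasDerivAt (fun y => N₂ y t) (N₃ x t) x)
    (hD : ∀ x t, HasDerivAt (fun y => D y t) (D₁ x t) x)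
    (hD₁ : ∀ x t, HasDerivAt (fun y => D₁ y t) (D₂ x t) x)
    (hD₂ : ∀ x t, HasDerivAt (fun y => D₂ y t) (D₃ x t) x)
    (hNt : ∀ x t, HasDerivAt (fun s => N x s) (Nt x t) t)
    (hDt : ∀ x t, HasDerivAt (fun s => D x s) (Dt x t) t)
    (hN₁t : ∀ x t, HasDerivAt (fun s => N₁ x s) (Nxt x t) t)
    (hD₁t : ∀ x t, HasDerivAt (fun s => D₁ x s) (Dxt x t) t)
    (hNtx : ∀ x t, HasDerivAt (fun y => Nt y t) (Nxt x t) x)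
    (hDtx : ∀ x t, HasDerivAt (fun y => Dt y t) (Dxt x t) x)
    (hW : ∀ x t, D x t ^ 2 + N x t ^ 2 ≠ 0)
    (bilin₂ : ∀ x t, D x t * D₂ x t - D₁ x t ^ 2 + N x t * N₂ x t - N₁ x t ^ 2 = 0)
    (bilin₃ : ∀ x t, Nt x t * D x t - N x t * Dt x t + N₃ x t * D x t
      - 3 * N₂ x t * D₁ x t + 3 * N₁ x t * D₂ x t - N x t * D₃ x t = 0) :
    MKdV fun x t => 2 * (N₁ x t * D x t - N x t * D₁ x t) / (D x t ^ 2 + N x t ^ 2) := by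
  set q : ℝ → ℝ → ℝ := fun x t =>
    2 * (N₁ x t * D x t - N x t * D₁ x t) / (D x t ^ 2 + N x t ^ 2) with hq
  -- `r` is the time derivative of the potential `2 arctan (N / D)`
  set r : ℝ → ℝ → ℝ := fun x t =>
    2 * (Nt x t * D x t - N x t * Dt x t) / (D x t ^ 2 + N x t ^ 2) with hr
  set q₁ : ℝ → ℝ → ℝ := fun x t =>
    (2 * (N₂ x t * D x t - N x t * D₂ x t) * (D x t ^ 2 + N x t ^ 2)
      - 2 * (N₁ x t * D x t - N x t * D₁ x t) * (2 * (D x t * D₁ x t + N x t * N₁ x t)))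
      / (D x t ^ 2 + N x t ^ 2) ^ 2 with hq₁
  have hqx : ∀ x t, HasDerivAt (fun y => q y t) (q₁ x t) x := by
    intro x t
    refine (((((hN₁ x t).mul (hD x t)).sub ((hN x t).mul (hD₁ x t))).const_mul 2).div
      (((hD x t).pow 2).add ((hN x t).pow 2)) (hW x t)).congr_deriv ?_
    simp only [hq₁, Pi.add_apply, Pi.sub_apply, Pi.mul_apply, Pi.pow_apply]
    congr 1
    push_cast
    ring
  have hqt : ∀ x t, ∃ c, HasDerivAt (fun s => q x s) c t ∧ HasDerivAt (fun y => r y t) c x := by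
    intro x t
    refine ⟨_, (((((hN₁t x t).mul (hDt x t)).sub ((hNt x t).mul (hD₁t x t))).const_mul 2).div
      (((hDt x t).pow 2).add ((hNt x t).pow 2)) (hW x t)), ?_⟩
    refine (((((hNtx x t).mul (hD x t)).sub ((hN x t).mul (hDtx x t))).const_mul 2).div
      (((hD x t).pow 2).add ((hN x t).pow 2)) (hW x t)).congr_deriv ?_
    simp only [Pi.add_apply, Pi.sub_apply, Pi.mul_apply, Pi.pow_apply]
    congr 1
    push_cast
    ring
  have hqxx : ∀ x t, HasDerivAt (fun y => q₁ y t) (-r x t - 2 * q x t ^ 3) x := by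
    intro x t
    have hWx := ((hD x t).pow 2).add ((hN x t).pow 2)
    have hnum := (((((hN₂ x t).mul (hD x t)).sub ((hN x t).mul (hD₂ x t))).const_mul 2).mul
      hWx).sub (((((hN₁ x t).mul (hD x t)).sub ((hN x t).mul (hD₁ x t))).const_mul 2).mul
      ((((hD x t).mul (hD₁ x t)).add ((hN x t).mul (hN₁ x t))).const_mul 2))
    refine (hnum.div (hWx.pow 2) (pow_ne_zero 2 (hW x t))).congr_deriv ?_
    have h₂ := bilin₂ x t
    have h₃ := bilin₃ x t
    have hw := hW x t
    simp only [hr, hq, Pi.add_apply, Pi.sub_apply, Pi.mul_apply, Pi.pow_apply]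
    generalize N x t = n at *
    generalize D x t = d at *
    generalize N₁ x t = n₁ at *
    generalize N₂ x t = n₂ at *
    generalize N₃ x t = n₃ at *
    generalize D₁ x t = d₁ at *
    generalize D₂ x t = d₂ at *
    generalize D₃ x t = d₃ at *
    generalize Nt x t = nt at *
    generalize Dt x t = dt at *
    field_simp
    push_cast
    linear_combination (d ^ 2 + n ^ 2) ^ 3 * h₃
      - (6 * (n₁ * d - n * d₁) * (d ^ 2 + n ^ 2) ^ 2) * h₂
  intro x t
  obtain ⟨c, hc, hrc⟩ := hqt x t
  have e₁ : pdx q = q₁ := funext₂ fun x t => (hqx x t).deriv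
  have e₂ : pdx q₁ = fun x t => -r x t - 2 * q x t ^ 3 := funext₂ fun x t => (hqxx x t).deriv
  have e₃ : pdx (fun x t => -r x t - 2 * q x t ^ 3) x t = -c - 6 * q x t ^ 2 * q₁ x t := by
    refine ((hrc.neg.sub (((hqx x t).pow 3).const_mul 2)).congr_deriv ?_).deriv
    push_cast
    ring
  have e₄ : pdt q x t = c := hc.deriv
  rw [e₁, e₂, e₃, e₄]
  ring

/-- Space derivative of the exponential phase of a soliton. -/
theorem hasDerivAt_exp_phase_x (b a x t : ℝ) :
    HasDerivAt (fun y => Real.exp (2 * b * (y - 4 * b ^ 2 * t) + a))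
      (2 * b * Real.exp (2 * b * (x - 4 * b ^ 2 * t) + a)) x := by
  refine (((((hasDerivAt_id x).sub_const (4 * b ^ 2 * t)).const_mul (2 * b)).add_const
    a).exp).congr_deriv ?_
  simp only [id]
  ring

/-- Time derivative of the exponential phase of a soliton. -/
theorem hasDerivAt_exp_phase_t (b a x t : ℝ) :
    HasDerivAt (fun s => Real.exp (2 * b * (x - 4 * b ^ 2 * s) + a))
      (-(2 * b) ^ 3 * Real.exp (2 * b * (x - 4 * b ^ 2 * t) + a)) t := by
  refine ((((((hasDerivAt_id t).const_mul (4 * b ^ 2)).const_sub x).const_mul (2 * b)).add_const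
    a).exp).congr_deriv ?_
  simp only [id]
  ring


/-- the 2-soliton is a smooth solution of the mKdV equation. -/
theorem mkdv_two_soliton (b₁ b₂ x₁ x₂ : ℝ) (hb₁ : 0 < b₁) (hb₂ : 0 < b₂)
    (hne : b₁ ≠ b₂)
    (B : ℝ) (hB : B = (b₁ - b₂) / (b₁ + b₂))
    (ξ₁ ξ₂ : ℝ → ℝ → ℝ)
    (hξ₁ : ξ₁ = fun x t => 2 * b₁ * (x - 4 * b₁ ^ 2 * t) + x₁)
    (hξ₂ : ξ₂ = fun x t => 2 * b₂ * (x - 4 * b₂ ^ 2 * t) + x₂)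
    (Nf Df : ℝ → ℝ → ℝ)
    (hN : Nf = fun x t => Real.exp (ξ₁ x t) + Real.exp (ξ₂ x t))
    (hD : Df = fun x t => 1 - B ^ 2 * Real.exp (ξ₁ x t + ξ₂ x t))
    (q : ℝ → ℝ → ℝ)
    (hq : q = fun x t =>
      2 * (pdx Nf x t * Df x t - Nf x t * pdx Df x t) /
        ((Df x t) ^ 2 + (Nf x t) ^ 2)) :
    ContDiff ℝ (⊤ : ℕ∞) (fun p : ℝ × ℝ => q p.1 p.2) ∧ MKdV q := by
  set E : ℝ → ℝ → ℝ := fun x t => Real.exp (ξ₁ x t) with hE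
  set F : ℝ → ℝ → ℝ := fun x t => Real.exp (ξ₂ x t) with hF
  have hEx : ∀ x t, HasDerivAt (fun y => E y t) (2 * b₁ * E x t) x := by
    subst hξ₁
    exact hasDerivAt_exp_phase_x b₁ x₁
  have hFx : ∀ x t, HasDerivAt (fun y => F y t) (2 * b₂ * F x t) x := by
    subst hξ₂
    exact hasDerivAt_exp_phase_x b₂ x₂
  have hEt : ∀ x t, HasDerivAt (fun s => E x s) (-(2 * b₁) ^ 3 * E x t) t := by
    subst hξ₁
    exact hasDerivAt_exp_phase_t b₁ x₁
  have hFt : ∀ x t, HasDerivAt (fun s => F x s) (-(2 * b₂) ^ 3 * F x t) t := by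
    subst hξ₂
    exact hasDerivAt_exp_phase_t b₂ x₂
  have hES : ContDiff ℝ (⊤ : ℕ∞) fun p : ℝ × ℝ => E p.1 p.2 := by
    simp only [hE, hξ₁]
    fun_prop
  have hFS : ContDiff ℝ (⊤ : ℕ∞) fun p : ℝ × ℝ => F p.1 p.2 := by
    simp only [hF, hξ₂]
    fun_prop
  have hE0 : ∀ x t, 0 < E x t := fun x t => Real.exp_pos _
  have hF0 : ∀ x t, 0 < F x t := fun x t => Real.exp_pos _
  have hN' : Nf = fun x t => E x t + F x t := hN
  have hD' : Df = fun x t => 1 - B ^ 2 * (E x t * F x t) := by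
    simp only [hD, hE, hF, Real.exp_add]
  clear_value E F
  -- space and time derivatives of linear combinations of `E`, `F`, and of `E F`
  have hlinx : ∀ α β x t, HasDerivAt (fun y => α * E y t + β * F y t)
      (α * (2 * b₁) * E x t + β * (2 * b₂) * F x t) x := fun α β x t =>
    (((hEx x t).const_mul α).add ((hFx x t).const_mul β)).congr_deriv (by ring)
  have hlint : ∀ α β x t, HasDerivAt (fun s => α * E x s + β * F x s)
      (α * -(2 * b₁) ^ 3 * E x t + β * -(2 * b₂) ^ 3 * F x t) t := fun α β x t =>
    (((hEt x t).const_mul α).add ((hFt x t).const_mul β)).congr_deriv (by ring)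
  have hprodx : ∀ α x t, HasDerivAt (fun y => α * (E y t * F y t))
      (α * (2 * b₁ + 2 * b₂) * (E x t * F x t)) x := fun α x t =>
    (((hEx x t).mul (hFx x t)).const_mul α).congr_deriv (by ring)
  have hprodt : ∀ α x t, HasDerivAt (fun s => α * (E x s * F x s))
      (α * -((2 * b₁) ^ 3 + (2 * b₂) ^ 3) * (E x t * F x t)) t := fun α x t =>
    (((hEt x t).mul (hFt x t)).const_mul α).congr_deriv (by ring)
  have hNx : ∀ x t, HasDerivAt (fun y => Nf y t) (2 * b₁ * E x t + 2 * b₂ * F x t) x := by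
    subst hN'
    exact fun x t => (hEx x t).add (hFx x t)
  have hNt : ∀ x t, HasDerivAt (fun s => Nf x s)
      (-(2 * b₁) ^ 3 * E x t + -(2 * b₂) ^ 3 * F x t) t := by
    subst hN'
    exact fun x t => (hEt x t).add (hFt x t)
  have hDx : ∀ x t, HasDerivAt (fun y => Df y t)
      (-(B ^ 2 * (2 * b₁ + 2 * b₂)) * (E x t * F x t)) x := by
    subst hD'
    exact fun x t => ((hprodx (B ^ 2) x t).const_sub 1).congr_deriv (by ring)
  have hDt : ∀ x t, HasDerivAt (fun s => Df x s)
      (B ^ 2 * ((2 * b₁) ^ 3 + (2 * b₂) ^ 3) * (E x t * F x t)) t := by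
    subst hD'
    exact fun x t => ((hprodt (B ^ 2) x t).const_sub 1).congr_deriv (by ring)
  have hpN : pdx Nf = fun x t => 2 * b₁ * E x t + 2 * b₂ * F x t :=
    funext₂ fun x t => (hNx x t).deriv
  have hpD : pdx Df = fun x t => -(B ^ 2 * (2 * b₁ + 2 * b₂)) * (E x t * F x t) :=
    funext₂ fun x t => (hDx x t).deriv
  have hW : ∀ x t, Df x t ^ 2 + Nf x t ^ 2 ≠ 0 := by
    intro x t
    have h : 0 < Nf x t := by
      rw [hN']
      exact add_pos (hE0 x t) (hF0 x t)
    positivity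
  have hBs : B * (b₁ + b₂) = b₁ - b₂ := by
    rw [hB]
    field_simp
  rw [hpN, hpD] at hq
  subst hq
  constructor
  · refine ContDiff.div ?_ ?_ fun p => hW p.1 p.2
    · simp only [hN', hD']
      fun_prop
    · simp only [hN', hD']
      fun_prop
  · refine mkdv_of_bilinear hNx (hlinx _ _) (hlinx _ _) hDx (hprodx _) (hprodx _) hNt hDt
      (hlint _ _) (hprodt _) (fun x t => (hlinx _ _ x t).congr_deriv (by ring))
      (fun x t => (hprodx _ x t).congr_deriv (by ring)) hW ?_ ?_
    · intro x t
      simp only [hN', hD']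
      linear_combination (-4 * (E x t * F x t) * (B * (b₁ + b₂) + (b₁ - b₂))) * hBs
    · intro x t
      simp only [hN', hD']
      ring
end
end

section
/- Let N ≥ 1 and let λ₁,…,λ_N ∈ ℂ be pairwise distinct with Im λ_k > 0 for all k. Let F₋ be the determinant of the N×N matrix with (i,j) entry (λ_i − λ_i*)/(λ_j − λ_i*), and for 1 ≤ k ≤ N let F^(k) be the determinant of the matrix obtained from it by replacing the k-th row by the row of all ones. Then F^(k) = − [ ∏_{j=1}^{N} (λ_k* − λ_j) ] / [ ( ∏_{j≠k} (λ_k* − λ_j*) ) · (λ_k − λ_k*) ] · F₋. -/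
open Finset BigOperators

noncomputable section

/-- If the nodes `a` are pairwise distinct and the root `b m` of `∏ j, (X - b j)` is not a node,
then the residues `r i` of `∏ j, (X - b j) / ∏ i, (X - a i)` at the `a i` satisfy
`∑ i, r i / (b m - a i) = -1`. -/
theorem sum_residue_div_sub_eq_neg_one {K ι : Type*} [Field K] [Fintype ι] [DecidableEq ι]
    {a b : ι → K} (ha : Function.Injective a) (m : ι) (hm : ∀ i, b m ≠ a i) :
    ∑ i, (∏ j, (a i - b j)) / (∏ j ∈ univ.erase i, (a i - a j)) / (b m - a i) = -1 := by
  have hdeg : (Lagrange.nodal univ b - Lagrange.nodal univ a).degree <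
      ((univ : Finset ι).card : WithBot ℕ) := by
    rw [← Lagrange.degree_nodal (s := univ) (v := b)]
    refine Polynomial.degree_sub_lt_left ?_ Lagrange.nodal_ne_zero ?_
    · rw [Lagrange.degree_nodal, Lagrange.degree_nodal]
    · rw [Lagrange.nodal_monic.leadingCoeff, Lagrange.nodal_monic.leadingCoeff]
  have h := congrArg (Polynomial.eval (b m)) (Lagrange.eq_interpolate ha.injOn hdeg)
  rw [Lagrange.eval_interpolate_not_at_node _ (fun i _ => hm i), Polynomial.eval_sub,
    Lagrange.eval_nodal_at_node (mem_univ m), zero_sub] at h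
  have hne : Polynomial.eval (b m) (Lagrange.nodal univ a) ≠ 0 := by
    rw [Lagrange.eval_nodal]
    exact prod_ne_zero_iff.mpr fun i _ => sub_ne_zero.mpr (hm i)
  refine mul_left_cancel₀ hne ?_
  have hsum : ∀ i, Polynomial.eval (a i) (Lagrange.nodal univ b - Lagrange.nodal univ a) =
      ∏ j, (a i - b j) := fun i => by
    rw [Polynomial.eval_sub, Lagrange.eval_nodal_at_node (mem_univ i), sub_zero,
      Lagrange.eval_nodal]
  rw [mul_neg_one, h]
  congr 1
  refine sum_congr rfl fun i _ => ?_
  rw [hsum, Lagrange.nodalWeight, prod_inv_distrib]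
  ring

/-- replacing the `k`-th row of the Cauchy-type matrix by a row
of ones multiplies its determinant by
`−(∏_j (λ_k* − λ_j)) / ((∏_{j≠k} (λ_k* − λ_j*)) (λ_k − λ_k*))`. -/
theorem cauchy_det_row_of_ones (N : ℕ) (hN : 1 ≤ N)
    (lam : Fin N → ℂ) (hinj : Function.Injective lam)
    (him : ∀ k, 0 < (lam k).im) (k : Fin N) :
    ((Matrix.of fun i j : Fin N =>
        (lam i - (starRingEnd ℂ) (lam i)) / (lam j - (starRingEnd ℂ) (lam i))).updateRow
      k (fun _ => 1)).det
    = -(∏ j, ((starRingEnd ℂ) (lam k) - lam j)) /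
        ((∏ j ∈ Finset.univ.filter (fun j => j ≠ k),
            ((starRingEnd ℂ) (lam k) - (starRingEnd ℂ) (lam j))) *
          (lam k - (starRingEnd ℂ) (lam k))) *
      (Matrix.of fun i j : Fin N =>
        (lam i - (starRingEnd ℂ) (lam i)) / (lam j - (starRingEnd ℂ) (lam i))).det := by
  have hne : ∀ i j, lam j - (starRingEnd ℂ) (lam i) ≠ 0 := fun i j h => by
    have h' := congrArg Complex.im h
    simp only [Complex.sub_im, Complex.conj_im, Complex.zero_im] at h'
    linarith [him i, him j]
  set M := Matrix.of fun i j : Fin N =>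
    (lam i - (starRingEnd ℂ) (lam i)) / (lam j - (starRingEnd ℂ) (lam i)) with hM
  let w : Fin N → ℂ := fun i => -(∏ j, ((starRingEnd ℂ) (lam i) - lam j)) /
    ((∏ j ∈ univ.erase i, ((starRingEnd ℂ) (lam i) - (starRingEnd ℂ) (lam j))) *
      (lam i - (starRingEnd ℂ) (lam i)))
  have hrow : (fun _ => 1 : Fin N → ℂ) = ∑ i, w i • M i := by
    funext m
    have h := sum_residue_div_sub_eq_neg_one (a := fun i => (starRingEnd ℂ) (lam i)) (b := lam)
      ((starRingEnd ℂ).injective.comp hinj) m fun i => sub_ne_zero.mp (hne i m)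
    rw [Finset.sum_apply, ← neg_eq_iff_eq_neg.mpr h, ← sum_neg_distrib]
    refine sum_congr rfl fun i _ => ?_
    have hi := hne i i
    simp only [w, hM, Pi.smul_apply, Matrix.of_apply, smul_eq_mul]
    rw [← div_div, div_mul_div_cancel₀ hi, neg_div, neg_div]
  rw [hrow, Matrix.det_updateRow_sum, smul_eq_mul, filter_ne']
end
end
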